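/- arXiv:1412.2561 — 2 statements merged into one kernel-verified Lean document; each statement's English description precedes it below -/
import Mathlib

section
/- Let G be a finite multigraph, t ≥ 1 an integer, and K a field of characteristic 0. Then dim_K B_G^{F_t} = Σ_F t^{|F|}, where the sum ranges over all subforests F of G, and this common value equals t^{v(G)−c(G)} · T_G(1 + 1/t, 1). -/
open MvPolynomial

namespace ForestAlg

variable {V E : Type*}

/-- Two vertices are directly connected by an edge of `A`. -/
def edgeRel (ends : E → Sym2 V) (A : Finset E) (v w : V) : Prop :=
  ∃ e ∈ A, ends e = s(v, w)

/-- Number of connected components of the spanning subgraph `(V, A)`. -/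
noncomputable def numComponents (ends : E → Sym2 V) (A : Finset E) : ℕ :=
  Nat.card (Quot (edgeRel ends A))

/-- Rank `r(A) = v(G) - c(V,A)`. -/
noncomputable def rank (ends : E → Sym2 V) (A : Finset E) : ℕ :=
  Nat.card V - numComponents ends A

/-- `A` is a subforest (contains no cycle): `|A| = v(G) - c(V,A)`. -/
def IsForest (ends : E → Sym2 V) (A : Finset E) : Prop :=
  A.card + numComponents ends A = Nat.card V

/-- The Tutte polynomial, evaluated at `(x, y)`. -/
noncomputable def tutte [Fintype E] {R : Type*} [CommRing R]
    (ends : E → Sym2 V) (x y : R) : R :=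
  ∑ A ∈ (Finset.univ : Finset E).powerset,
    (x - 1) ^ (rank ends Finset.univ - rank ends A) *
      (y - 1) ^ (A.card - rank ends A)

/-- `e ∉ F` is externally active for the subforest `F` with respect to the linear
order `o`: `F + e` contains a cycle and `e` is the minimal edge of that cycle
(the edges of the unique cycle of `F + e` are those whose removal does not
decrease the rank). -/
def ExtActive [DecidableEq E] (o : LinearOrder E) (ends : E → Sym2 V)
    (F : Finset E) (e : E) : Prop :=
  e ∉ F ∧ ¬ IsForest ends (insert e F) ∧
    ∀ f ∈ insert e F,
      rank ends ((insert e F).erase f) = rank ends (insert e F) → o.le e f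

/-- External activity `act_G(F)`. -/
noncomputable def act [DecidableEq E] (o : LinearOrder E) (ends : E → Sym2 V)
    (F : Finset E) : ℕ :=
  Set.ncard {e : E | ExtActive o ends F e}

/-- `D_I`: number of edges with one endpoint in `I` and the other outside `I`. -/
noncomputable def crossCount {n : ℕ} (ends : E → Sym2 (Fin n))
    (I : Finset (Fin n)) : ℕ :=
  Set.ncard {e : E | (∃ v ∈ ends e, v ∈ I) ∧ ∃ w ∈ ends e, w ∉ I}

/-- The ideal `J_G^{F_t}` generated by `(∑_{i ∈ I} x_i)^{t·D_I + 1}` over nonempty `I`. -/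
noncomputable def forestIdeal (K : Type*) [Field K] {n : ℕ} (t : ℕ)
    (ends : E → Sym2 (Fin n)) : Ideal (MvPolynomial (Fin n) K) :=
  Ideal.span {p | ∃ I : Finset (Fin n), I.Nonempty ∧
    p = (∑ i ∈ I, X i) ^ (t * crossCount ends I + 1)}

/-- The `k`-th graded component of `K[x_1,…,x_n]/J` (for homogeneous `J`):
the image of the degree-`k` homogeneous part in the quotient. -/
noncomputable def gradedPiece (K : Type*) [Field K] {n : ℕ}
    (J : Ideal (MvPolynomial (Fin n) K)) (k : ℕ) :
    Submodule K (MvPolynomial (Fin n) K ⧸ J) :=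
  Submodule.map (Ideal.Quotient.mkₐ K J).toLinearMap
    (homogeneousSubmodule (Fin n) K k)

/-- Dimension of the `k`-th graded component of the quotient. -/
noncomputable def gradedDim (K : Type*) [Field K] {n : ℕ}
    (J : Ideal (MvPolynomial (Fin n) K)) (k : ℕ) : ℕ :=
  Module.finrank K (gradedPiece K J k)


section Forests

open scoped Classical in
/-- The retraction of `V` that merges the vertex `v` into the vertex `u`. -/
noncomputable def mergeVertex (u v : V) : V → V := Function.update id v u

lemma mergeVertex_self (u v : V) : mergeVertex u v v = u := by simp [mergeVertex]

lemma mergeVertex_of_ne (u : V) {v w : V} (h : w ≠ v) : mergeVertex u v w = w := by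
  simp [mergeVertex, h]

lemma mergeVertex_left (u v : V) : mergeVertex u v u = u := by
  by_cases h : u = v
  · subst h; exact mergeVertex_self u u
  · exact mergeVertex_of_ne u h

lemma mergeVertex_ne {u v : V} (h : u ≠ v) (w : V) : mergeVertex u v w ≠ v := by
  by_cases hw : w = v
  · rwa [hw, mergeVertex_self]
  · rwa [mergeVertex_of_ne u hw]

lemma edgeRel_mono (ends : E → Sym2 V) {A B : Finset E} (h : A ⊆ B) {v w : V} :
    edgeRel ends A v w → edgeRel ends B v w :=
  fun ⟨e, he, hvw⟩ => ⟨e, h he, hvw⟩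

lemma numComponents_empty (ends : E → Sym2 V) : numComponents ends ∅ = Nat.card V :=
  Nat.card_congr
    { toFun := Quot.lift id fun _ _ ⟨_, he, _⟩ => absurd he (Finset.notMem_empty _)
      invFun := Quot.mk _
      left_inv := by rintro ⟨v⟩; rfl
      right_inv := fun _ => rfl }

lemma numComponents_le_card [Finite V] (ends : E → Sym2 V) (A : Finset E) :
    numComponents ends A ≤ Nat.card V :=
  Nat.card_le_card_of_surjective _ Quot.mk_surjective

lemma numComponents_anti [Finite V] (ends : E → Sym2 V) {A B : Finset E} (h : A ⊆ B) :
    numComponents ends B ≤ numComponents ends A :=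
  Nat.card_le_card_of_surjective (Quot.map id fun _ _ => edgeRel_mono ends h) <| by
    rintro ⟨v⟩
    exact ⟨Quot.mk _ v, rfl⟩

variable [DecidableEq E]

lemma numComponents_insert_loop {ends : E → Sym2 V} {e : E} {u : V} (he : ends e = s(u, u))
    (A : Finset E) : numComponents ends (insert e A) = numComponents ends A :=
  Nat.card_congr
    { toFun := Quot.lift (Quot.mk _) <| by
        rintro x y ⟨f, hf, hxy⟩
        rcases Finset.mem_insert.mp hf with rfl | hf
        · have : x = y := by
            rw [he, Sym2.eq_iff] at hxy
            rcases hxy with ⟨rfl, rfl⟩ | ⟨rfl, rfl⟩ <;> rfl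
          rw [this]
        · exact Quot.sound ⟨f, hf, hxy⟩
      invFun := Quot.map id fun _ _ => edgeRel_mono ends (Finset.subset_insert e A)
      left_inv := by rintro ⟨v⟩; rfl
      right_inv := by rintro ⟨v⟩; rfl }

open scoped Classical in
lemma numComponents_mergeVertex [Finite V] {ends : E → Sym2 V} {e : E} {u v : V} (huv : u ≠ v)
    (he : ends e = s(u, v)) (A : Finset E) :
    numComponents (Sym2.map (mergeVertex u v) ∘ ends) A
      = numComponents ends (insert e A) + 1 := by
  have mk_merge (x : V) : Quot.mk (edgeRel ends (insert e A)) (mergeVertex u v x)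
      = Quot.mk (edgeRel ends (insert e A)) x := by
    by_cases hx : x = v
    · rw [hx, mergeVertex_self]
      exact Quot.sound ⟨e, Finset.mem_insert_self e A, he⟩
    · rw [mergeVertex_of_ne u hx]
  unfold numComponents
  rw [← Finite.card_option]
  refine Nat.card_congr
    { toFun := Quot.lift (fun x => if x = v then none else some (Quot.mk _ x)) ?_
      invFun := fun o => o.elim (Quot.mk _ v)
        (Quot.lift (fun x => Quot.mk _ (mergeVertex u v x)) ?_)
      left_inv := ?_
      right_inv := ?_ }
  · rintro x y ⟨f, hf, hxy⟩
    induction hz : ends f with | _ a b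
    have key : Quot.mk (edgeRel ends (insert e A)) (mergeVertex u v a)
        = Quot.mk (edgeRel ends (insert e A)) (mergeVertex u v b) := by
      rw [mk_merge, mk_merge]
      exact Quot.sound ⟨f, Finset.mem_insert_of_mem hf, hz⟩
    simp only [Function.comp_apply, hz, Sym2.map_mk, Sym2.eq_iff] at hxy
    rcases hxy with ⟨rfl, rfl⟩ | ⟨rfl, rfl⟩
    · simp [mergeVertex_ne huv, key]
    · simp [mergeVertex_ne huv, key]
  · rintro x y ⟨f, hf, hxy⟩
    rcases Finset.mem_insert.mp hf with rfl | hf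
    · rw [he, Sym2.eq_iff] at hxy
      rcases hxy with ⟨rfl, rfl⟩ | ⟨rfl, rfl⟩ <;> simp [mergeVertex_self, mergeVertex_left]
    · exact Quot.sound ⟨f, hf, by simp [hxy]⟩
  · rintro ⟨x⟩
    by_cases hx : x = v
    · simp [hx]
    · simp [hx, mergeVertex_of_ne]
  · rintro (_ | x)
    · simp
    · induction x using Quot.ind
      simp [mergeVertex_ne huv, mk_merge]

lemma card_le_card_add_numComponents [Finite V] (ends : E → Sym2 V) (A : Finset E) :
    Nat.card V ≤ A.card + numComponents ends A := by
  induction A using Finset.induction generalizing ends with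
  | empty => simp [numComponents_empty]
  | insert e A heA ih =>
    rw [Finset.card_insert_of_notMem heA]
    induction he : ends e with | _ u v
    by_cases huv : u = v
    · subst huv
      have := ih ends
      rw [numComponents_insert_loop he]
      omega
    · have := ih (Sym2.map (mergeVertex u v) ∘ ends)
      rw [numComponents_mergeVertex huv he] at this
      omega

lemma not_isForest_insert_loop [Finite V] {ends : E → Sym2 V} {e : E} {u : V}
    (he : ends e = s(u, u)) {A : Finset E} (heA : e ∉ A) : ¬ IsForest ends (insert e A) := by
  have := card_le_card_add_numComponents ends A
  rw [IsForest, numComponents_insert_loop he, Finset.card_insert_of_notMem heA]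
  omega

lemma isForest_insert_iff [Finite V] {ends : E → Sym2 V} {e : E} {u v : V} (huv : u ≠ v)
    (he : ends e = s(u, v)) {A : Finset E} (heA : e ∉ A) :
    IsForest ends (insert e A) ↔ IsForest (Sym2.map (mergeVertex u v) ∘ ends) A := by
  rw [IsForest, IsForest, numComponents_mergeVertex huv he, Finset.card_insert_of_notMem heA]
  omega

open scoped Classical in
lemma sum_forests_eq_tutte [Fintype E] [Finite V] (ends : E → Sym2 V) {t : ℕ} (ht : t ≠ 0) :
    ((∑ A ∈ (Finset.univ : Finset E).powerset,
        if IsForest ends A then t ^ A.card else 0 : ℕ) : ℚ)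
      = (t : ℚ) ^ (Nat.card V - numComponents ends (Finset.univ : Finset E))
        * tutte ends (1 + 1 / (t : ℚ)) 1 := by
  rw [tutte, Finset.mul_sum, Nat.cast_sum]
  refine Finset.sum_congr rfl fun A _ => ?_
  have h1 := card_le_card_add_numComponents ends A
  have h2 := numComponents_le_card ends A
  have h3 := numComponents_anti ends (Finset.subset_univ A)
  simp only [rank, add_sub_cancel_left, sub_self]
  by_cases hA : IsForest ends A
  · rw [if_pos hA]
    rw [IsForest] at hA
    have h4 : A.card - (Nat.card V - numComponents ends A) = 0 := by omega
    obtain ⟨k, hk⟩ : ∃ k, Nat.card V - numComponents ends Finset.univ = A.card + k :=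
      ⟨_, (Nat.add_sub_cancel' (by omega)).symm⟩
    have h5 : Nat.card V - numComponents ends Finset.univ
        - (Nat.card V - numComponents ends A) = k := by omega
    have ht' : (t : ℚ) ≠ 0 := by exact_mod_cast ht
    rw [h4, h5, hk]
    push_cast
    rw [pow_zero, mul_one, pow_add, one_div, inv_pow, mul_assoc,
      mul_inv_cancel₀ (pow_ne_zero k ht'), mul_one]
  · have h4 : A.card - (Nat.card V - numComponents ends A) ≠ 0 := by
      rw [IsForest] at hA
      omega
    simp [hA, h4]

end Forests

section InverseSystem

variable {σ : Type*} (K : Type*) [Field K]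

/-- The linear form `x_u - x_v` of an oriented edge `(u, v)`. -/
noncomputable def edgeForm (e : σ × σ) : MvPolynomial σ K := X e.1 - X e.2

/-- The span of the products of the edge forms over all sublists of `L`. -/
noncomputable def prodSpan : List (σ × σ) → Submodule K (MvPolynomial σ K)
  | [] => Submodule.span K {1}
  | e :: L => prodSpan L ⊔ (prodSpan L).map (LinearMap.mulLeft K (edgeForm K e))

variable {K}

lemma edgeForm_ne_zero {e : σ × σ} (h : e.1 ≠ e.2) : edgeForm K e ≠ 0 :=
  sub_ne_zero.mpr fun hX => h (X_injective hX)

lemma edgeForm_loop {e : σ × σ} (he : e.1 = e.2) : edgeForm K e = 0 := by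
  rw [edgeForm, he, sub_self]

lemma rename_edgeForm (π : σ → σ) (e : σ × σ) :
    rename π (edgeForm K e) = edgeForm K (Prod.map π π e) := by
  simp [edgeForm]

lemma rename_edgeForm_merge (e : σ × σ) :
    rename (mergeVertex e.1 e.2) (edgeForm K e) = 0 := by
  simp [edgeForm, mergeVertex_self, mergeVertex_left]

lemma edgeForm_dvd_of_rename_eq_zero (e : σ × σ) {f : MvPolynomial σ K}
    (hf : rename (mergeVertex e.1 e.2) f = 0) : edgeForm K e ∣ f := by
  rw [← Ideal.mem_span_singleton, ← Ideal.Quotient.eq_zero_iff_mem]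
  have key : (Ideal.Quotient.mkₐ K (Ideal.span {edgeForm K e})).comp
      (rename (mergeVertex e.1 e.2)) = Ideal.Quotient.mkₐ K (Ideal.span {edgeForm K e}) := by
    ext i
    by_cases hi : i = e.2
    · simp only [AlgHom.comp_apply, rename_X, hi, mergeVertex_self, Ideal.Quotient.mkₐ_eq_mk]
      exact Ideal.Quotient.eq.mpr (Ideal.mem_span_singleton_self _)
    · simp [mergeVertex_of_ne, hi]
  have := DFunLike.congr_fun key f
  simpa [hf] using this.symm

lemma map_rename_prodSpan (π : σ → σ) (L : List (σ × σ)) :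
    (prodSpan K L).map (rename π : _ →ₐ[K] MvPolynomial σ K).toLinearMap
      = prodSpan K (L.map (Prod.map π π)) := by
  induction L with
  | nil => simp [prodSpan, Submodule.map_span]
  | cons e L ih =>
    have h : (rename π : _ →ₐ[K] MvPolynomial σ K).toLinearMap ∘ₗ
          LinearMap.mulLeft K (edgeForm K e)
        = LinearMap.mulLeft K (edgeForm K (Prod.map π π e)) ∘ₗ
          (rename π : _ →ₐ[K] MvPolynomial σ K).toLinearMap :=
      LinearMap.ext fun p => by simp [rename_edgeForm]
    rw [List.map_cons, prodSpan, prodSpan, Submodule.map_sup, ← ih, ← Submodule.map_comp, h,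
      Submodule.map_comp]

variable [DecidableEq σ] (K)

/-- The derivation `∑_{i ∈ I} ∂/∂x_i`. -/
noncomputable def dirDeriv (I : Finset σ) :
    Derivation K (MvPolynomial σ K) (MvPolynomial σ K) :=
  mkDerivation K fun i => if i ∈ I then 1 else 0

/-- The polynomials annihilated by `(∑_{i ∈ I} ∂/∂x_i) ^ (D I + 1)` for every `I`. -/
noncomputable def invSystem (D : Finset σ → ℕ) : Submodule K (MvPolynomial σ K) :=
  ⨅ I, LinearMap.ker ((dirDeriv K I).toLinearMap ^ (D I + 1))

/-- The number of edges in the list `L` that have exactly one endpoint in `I`. -/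
def listCrossCount (L : List (σ × σ)) (I : Finset σ) : ℕ :=
  L.countP fun e => ¬(e.1 ∈ I ↔ e.2 ∈ I)

variable {K}

lemma dirDeriv_X (I : Finset σ) (i : σ) :
    dirDeriv K I (X i) = if i ∈ I then 1 else 0 := mkDerivation_X _ _ _

lemma dirDeriv_eq_sum (I : Finset σ) (f : MvPolynomial σ K) :
    dirDeriv K I f = ∑ i ∈ I, pderiv i f := by
  have hsum : ⇑(∑ i ∈ I, pderiv i : Derivation K (MvPolynomial σ K) (MvPolynomial σ K))
      = ∑ i ∈ I, ⇑(pderiv i) := map_sum Derivation.coeFnAddMonoidHom _ _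
  have h : dirDeriv K I = ∑ i ∈ I, pderiv i := derivation_ext fun j => by
    rw [dirDeriv_X, hsum, Finset.sum_apply]
    simp [pderiv_X, Pi.single_apply]
  rw [h, hsum, Finset.sum_apply]

lemma mem_invSystem {D : Finset σ → ℕ} {f : MvPolynomial σ K} :
    f ∈ invSystem K D ↔ ∀ I, (dirDeriv K I)^[D I + 1] f = 0 := by
  simp [invSystem, Module.End.pow_apply]

lemma invSystem_mono {D D' : Finset σ → ℕ} (h : ∀ I, D I ≤ D' I) :
    invSystem K D ≤ invSystem K D' := by
  intro f hf
  rw [mem_invSystem] at hf ⊢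
  intro I
  obtain ⟨k, hk⟩ := Nat.exists_eq_add_of_le (h I)
  rw [show D' I + 1 = k + (D I + 1) by omega, Function.iterate_add_apply, hf, iterate_map_zero]

lemma iterate_derivation_mul_of_eq_zero {R A : Type*} [CommRing R] [CommRing A] [Algebra R A]
    (d : Derivation R A A) {a : A} (ha : d (d a) = 0) (b : A) (k : ℕ) :
    d^[k + 1] (a * b) = a * d^[k + 1] b + (k + 1) * d a * d^[k] b := by
  induction k with
  | zero => simp [mul_comm]
  | succ k ih =>
    rw [Function.iterate_succ_apply', ih, Function.iterate_succ_apply' d (k + 1) b,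
      Function.iterate_succ_apply' d k b]
    have hk : d ((k : A) + 1) = 0 := by
      rw [map_add, Derivation.map_natCast, Derivation.map_one_eq_zero, add_zero]
    simp only [map_add, Derivation.leibniz, smul_eq_mul, ha, hk]
    push_cast
    ring

lemma dirDeriv_dirDeriv_X (I : Finset σ) (i : σ) :
    dirDeriv K I (dirDeriv K I (X i)) = 0 := by
  rw [dirDeriv_X]
  split_ifs <;> simp

lemma dirDeriv_edgeForm (I : Finset σ) (e : σ × σ) :
    dirDeriv K I (edgeForm K e)
      = (if e.1 ∈ I then 1 else 0) - (if e.2 ∈ I then 1 else 0) := by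
  rw [edgeForm, map_sub, dirDeriv_X, dirDeriv_X]

lemma dirDeriv_dirDeriv_edgeForm (I : Finset σ) (e : σ × σ) :
    dirDeriv K I (dirDeriv K I (edgeForm K e)) = 0 := by
  rw [edgeForm, map_sub, map_sub, dirDeriv_dirDeriv_X, dirDeriv_dirDeriv_X, sub_zero]

lemma dirDeriv_nilpotent (I : Finset σ) (f : MvPolynomial σ K) :
    ∃ N, (dirDeriv K I)^[N] f = 0 := by
  induction f using MvPolynomial.induction_on with
  | C a => exact ⟨1, by simp⟩
  | add p q hp hq =>
    obtain ⟨N, hN⟩ := hp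
    obtain ⟨M, hM⟩ := hq
    refine ⟨N + M, ?_⟩
    rw [iterate_map_add, Function.iterate_add_apply _ _ _ q, hM, add_comm N M,
      Function.iterate_add_apply, hN]
    simp
  | mul_X p i hp =>
    obtain ⟨N, hN⟩ := hp
    refine ⟨N + 1, ?_⟩
    rw [mul_comm, iterate_derivation_mul_of_eq_zero _ (dirDeriv_dirDeriv_X I i),
      Function.iterate_succ_apply', hN]
    simp

/-- If `d ℓ` is a nonzero constant, then multiplication by `ℓ` raises the order of `d`-nilpotency
by exactly one. -/
lemma iterate_eq_zero_of_iterate_mul_eq_zero {R A : Type*} [CommRing R] [CommRing A] [IsDomain A]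
    [CharZero A] [Algebra R A] (d : Derivation R A A) {a b : A} (ha : d a ≠ 0)
    (hda : d (d a) = 0) (hb : ∃ N, d^[N] b = 0) {k : ℕ} (h : d^[k + 1] (a * b) = 0) :
    d^[k] b = 0 := by
  classical
  have hm := Nat.find_spec hb
  by_contra hk
  obtain ⟨j, hj⟩ : ∃ j, Nat.find hb = k + j + 1 := by
    have : k < Nat.find hb := by
      by_contra hlt
      obtain ⟨i, hi⟩ := Nat.exists_eq_add_of_le (not_lt.mp hlt)
      apply hk
      rw [hi, add_comm, Function.iterate_add_apply, hm, iterate_map_zero]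
    exact ⟨Nat.find hb - k - 1, by omega⟩
  have hprev : d^[k + j] b ≠ 0 := Nat.find_min hb (by omega)
  have h1 : d^[k + j + 1] (a * b) = 0 := by
    rw [show k + j + 1 = j + (k + 1) by omega, Function.iterate_add_apply, h, iterate_map_zero]
  rw [iterate_derivation_mul_of_eq_zero d hda, ← hj, hm, mul_zero, zero_add] at h1
  have hc : ((k + j : ℕ) : A) + 1 ≠ 0 := Nat.cast_add_one_ne_zero _
  exact mul_ne_zero (mul_ne_zero hc ha) hprev h1

lemma iterate_derivation_mul_of_const {R A : Type*} [CommRing R] [CommRing A] [Algebra R A]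
    (d : Derivation R A A) {a : A} (ha : d a = 0) (b : A) (k : ℕ) :
    d^[k] (a * b) = a * d^[k] b := by
  induction k with
  | zero => rfl
  | succ k ih =>
    rw [Function.iterate_succ_apply', ih, Function.iterate_succ_apply' d k b]
    simp [Derivation.leibniz, ha]

lemma listCrossCount_cons (e : σ × σ) (L : List (σ × σ)) (I : Finset σ) :
    listCrossCount (e :: L) I
      = listCrossCount L I + if (e.1 ∈ I ↔ e.2 ∈ I) then 0 else 1 := by
  simp [listCrossCount, List.countP_cons]

lemma listCrossCount_map [Fintype σ] (π : σ → σ) (L : List (σ × σ)) (I : Finset σ) :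
    listCrossCount (L.map (Prod.map π π)) I
      = listCrossCount L (Finset.univ.filter fun i => π i ∈ I) := by
  simp [listCrossCount, List.countP_map, Function.comp_def]

lemma dirDeriv_edgeForm_eq_zero {I : Finset σ} {e : σ × σ} (h : e.1 ∈ I ↔ e.2 ∈ I) :
    dirDeriv K I (edgeForm K e) = 0 := by
  simp [dirDeriv_edgeForm, h]

lemma dirDeriv_edgeForm_ne_zero {I : Finset σ} {e : σ × σ} (h : ¬(e.1 ∈ I ↔ e.2 ∈ I)) :
    dirDeriv K I (edgeForm K e) ≠ 0 := by
  rw [dirDeriv_edgeForm]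
  by_cases h1 : e.1 ∈ I <;> by_cases h2 : e.2 ∈ I <;> simp_all

lemma edgeForm_mul_mem_invSystem_iff [CharZero K] {e : σ × σ} (he : e.1 ≠ e.2)
    (L : List (σ × σ)) (g : MvPolynomial σ K) :
    edgeForm K e * g ∈ invSystem K (listCrossCount (e :: L))
      ↔ g ∈ invSystem K (listCrossCount L) := by
  simp only [mem_invSystem]
  refine forall_congr' fun I => ?_
  rw [listCrossCount_cons]
  split_ifs with h
  · rw [iterate_derivation_mul_of_const _ (dirDeriv_edgeForm_eq_zero h), add_zero]
    simp [edgeForm_ne_zero he]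
  · refine ⟨iterate_eq_zero_of_iterate_mul_eq_zero _ (dirDeriv_edgeForm_ne_zero h)
      (dirDeriv_dirDeriv_edgeForm I e) (dirDeriv_nilpotent I g), fun hg => ?_⟩
    rw [iterate_derivation_mul_of_eq_zero _ (dirDeriv_dirDeriv_edgeForm I e),
      Function.iterate_succ_apply', hg]
    simp

lemma listCrossCount_loop {e : σ × σ} (he : e.1 = e.2) (L : List (σ × σ)) :
    listCrossCount (e :: L) = listCrossCount L := by
  ext I
  simp [listCrossCount_cons, he]

lemma prodSpan_le_invSystem [CharZero K] (L : List (σ × σ)) :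
    prodSpan K L ≤ invSystem K (listCrossCount L) := by
  induction L with
  | nil =>
    rw [prodSpan, Submodule.span_singleton_le_iff_mem, mem_invSystem]
    intro I
    simp
  | cons e L ih =>
    refine sup_le (ih.trans (invSystem_mono fun I => ?_)) ?_
    · rw [listCrossCount_cons]
      exact Nat.le_add_right _ _
    · rintro _ ⟨g, hg, rfl⟩
      rw [LinearMap.mulLeft_apply]
      by_cases he : e.1 = e.2
      · rw [edgeForm_loop he, zero_mul]
        exact zero_mem _
      · exact (edgeForm_mul_mem_invSystem_iff he L g).mpr (ih hg)

lemma dirDeriv_rename [Fintype σ] (π : σ → σ) (I : Finset σ) (f : MvPolynomial σ K) :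
    dirDeriv K I (rename π f)
      = rename π (dirDeriv K (Finset.univ.filter fun i => π i ∈ I) f) := by
  induction f using MvPolynomial.induction_on with
  | C a => simp
  | add p q hp hq => simp [hp, hq]
  | mul_X p i hp =>
    simp only [map_mul, rename_X, Derivation.leibniz, hp, dirDeriv_X, smul_eq_mul, map_add,
      Finset.mem_filter, Finset.mem_univ, true_and]
    split_ifs <;> simp

lemma rename_mem_invSystem [Fintype σ] {e : σ × σ} {L : List (σ × σ)} {f : MvPolynomial σ K}
    (hf : f ∈ invSystem K (listCrossCount (e :: L))) :
    rename (mergeVertex e.1 e.2) f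
      ∈ invSystem K (listCrossCount (L.map (Prod.map (mergeVertex e.1 e.2)
          (mergeVertex e.1 e.2)))) := by
  rw [mem_invSystem] at hf ⊢
  intro I
  have key (k : ℕ) : (dirDeriv K I)^[k] (rename (mergeVertex e.1 e.2) f)
      = rename (mergeVertex e.1 e.2)
        ((dirDeriv K (Finset.univ.filter fun i => mergeVertex e.1 e.2 i ∈ I))^[k] f) := by
    induction k with
    | zero => rfl
    | succ k ih => rw [Function.iterate_succ_apply', ih, dirDeriv_rename,
        Function.iterate_succ_apply']
  have h := hf (Finset.univ.filter fun i => mergeVertex e.1 e.2 i ∈ I)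
  rw [listCrossCount_cons, if_pos (by simp [mergeVertex_self, mergeVertex_left]), add_zero] at h
  rw [key, listCrossCount_map, h, map_zero]

lemma invSystem_eq_prodSpan_nil [CharZero K] :
    invSystem K (listCrossCount ([] : List (σ × σ))) = prodSpan K [] := by
  refine le_antisymm (fun f hf => ?_) (prodSpan_le_invSystem _)
  rw [prodSpan, Submodule.mem_span_singleton]
  refine ⟨coeff 0 f, ?_⟩
  ext m
  rw [coeff_smul, coeff_one]
  split_ifs with hm
  · simp [← hm]
  · obtain ⟨i, hi⟩ : ∃ i, m i ≠ 0 := by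
      by_contra! h
      exact hm (Finsupp.ext fun i => (h i).symm)
    have h1 := mem_invSystem.mp hf {i}
    simp only [listCrossCount, List.countP_nil, zero_add, Function.iterate_one,
      dirDeriv_eq_sum, Finset.sum_singleton] at h1
    have h2 := coeff_pderiv (i := i) f (m - Finsupp.single i 1)
    rw [h1, coeff_zero, tsub_add_cancel_of_le (Finsupp.single_le_iff.mpr
      (Nat.one_le_iff_ne_zero.mpr hi))] at h2
    rcases mul_eq_zero.mp h2.symm with h3 | h3
    · simp [h3]
    · exact absurd h3 (Nat.cast_add_one_ne_zero _)

theorem invSystem_eq_prodSpan [CharZero K] [Fintype σ] (L : List (σ × σ)) :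
    invSystem K (listCrossCount L) = prodSpan K L := by
  induction hn : L.length generalizing L with
  | zero =>
    rw [List.length_eq_zero_iff.mp hn]
    exact invSystem_eq_prodSpan_nil
  | succ n ih =>
    obtain ⟨e, L, rfl⟩ := List.exists_cons_of_length_eq_add_one hn
    rw [List.length_cons, add_left_inj] at hn
    refine le_antisymm (fun f hf => ?_) (prodSpan_le_invSystem _)
    rw [prodSpan]
    by_cases he : e.1 = e.2
    · rw [listCrossCount_loop he, ih L hn] at hf
      exact Submodule.mem_sup_left hf
    · have h1 := rename_mem_invSystem hf
      rw [ih _ (by rw [List.length_map, hn]), ← map_rename_prodSpan] at h1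
      obtain ⟨p, hp, hpf⟩ := h1
      have h2 : rename (mergeVertex e.1 e.2) (f - p) = 0 := by
        rw [map_sub, sub_eq_zero]
        exact hpf.symm
      obtain ⟨g, hg⟩ := edgeForm_dvd_of_rename_eq_zero e h2
      have hp' : p ∈ invSystem K (listCrossCount (e :: L)) :=
        prodSpan_le_invSystem _ (Submodule.mem_sup_left hp)
      have h3 := sub_mem hf hp'
      rw [hg, edgeForm_mul_mem_invSystem_iff he, ih L hn] at h3
      rw [← sub_add_cancel f p, hg, add_comm]
      exact Submodule.add_mem_sup hp ⟨g, h3, rfl⟩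

instance finiteDimensional_prodSpan (L : List (σ × σ)) :
    FiniteDimensional K (prodSpan K L) := by
  induction L with
  | nil => rw [prodSpan]; infer_instance
  | cons e L ih => rw [prodSpan]; infer_instance

lemma finrank_invSystem_nil [CharZero K] :
    Module.finrank K (invSystem K (listCrossCount ([] : List (σ × σ)))) = 1 := by
  rw [invSystem_eq_prodSpan_nil, prodSpan, finrank_span_singleton one_ne_zero]

/-- The deletion-contraction recurrence for the dimension of the inverse system. -/
theorem finrank_invSystem_cons [CharZero K] [Fintype σ] {e : σ × σ} (he : e.1 ≠ e.2)
    (L : List (σ × σ)) :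
    Module.finrank K (invSystem K (listCrossCount (e :: L)))
      = Module.finrank K (invSystem K (listCrossCount L))
        + Module.finrank K (invSystem K (listCrossCount
            (L.map (Prod.map (mergeVertex e.1 e.2) (mergeVertex e.1 e.2))))) := by
  have : FiniteDimensional K (invSystem K (listCrossCount (e :: L))) := by
    rw [invSystem_eq_prodSpan]
    infer_instance
  set ρ : MvPolynomial σ K →ₗ[K] MvPolynomial σ K :=
    (rename (mergeVertex e.1 e.2) : _ →ₐ[K] MvPolynomial σ K).toLinearMap
  set W := invSystem K (listCrossCount (e :: L))
  have h := (ρ.domRestrict W).finrank_range_add_finrank_ker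
  have hrange : LinearMap.range (ρ.domRestrict W) = invSystem K (listCrossCount
      (L.map (Prod.map (mergeVertex e.1 e.2) (mergeVertex e.1 e.2)))) := by
    rw [LinearMap.range_domRestrict]
    apply le_antisymm
    · rintro _ ⟨f, hf, rfl⟩
      exact rename_mem_invSystem hf
    · rw [invSystem_eq_prodSpan, ← map_rename_prodSpan]
      refine Submodule.map_mono (le_trans ?_ (prodSpan_le_invSystem _))
      rw [prodSpan]
      exact le_sup_left
  have hker : (LinearMap.ker (ρ.domRestrict W)).map W.subtype
      = (invSystem K (listCrossCount L)).map (LinearMap.mulLeft K (edgeForm K e)) := by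
    ext f
    constructor
    · rintro ⟨⟨f, hf⟩, hf0, rfl⟩
      obtain ⟨g, rfl⟩ := edgeForm_dvd_of_rename_eq_zero e (f := f) hf0
      exact ⟨g, (edgeForm_mul_mem_invSystem_iff he L g).mp hf, rfl⟩
    · rintro ⟨g, hg, rfl⟩
      refine ⟨⟨edgeForm K e * g, (edgeForm_mul_mem_invSystem_iff he L g).mpr hg⟩, ?_, rfl⟩
      change rename _ (edgeForm K e * g) = 0
      rw [map_mul, rename_edgeForm_merge, zero_mul]
  rw [hrange, ← Submodule.finrank_map_subtype_eq, hker, ← (Submodule.equivMapOfInjective _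
    (mul_right_injective₀ (edgeForm_ne_zero he)) _).finrank_eq] at h
  rw [← h, add_comm]

end InverseSystem

section Duality

variable {σ : Type*} {K : Type*} [Field K]

/-- The ideal generated by the powers `(∑_{i ∈ I} x_i) ^ (D I + 1)` over nonempty `I`. -/
noncomputable def powerIdeal (K : Type*) [Field K] (D : Finset σ → ℕ) :
    Ideal (MvPolynomial σ K) :=
  Ideal.span {p | ∃ I : Finset σ, I.Nonempty ∧ p = (∑ i ∈ I, X i) ^ (D I + 1)}

lemma monomial_mem_powerIdeal (D : Finset σ → ℕ) {m : σ →₀ ℕ} {i : σ} (h : D {i} < m i) :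
    monomial m (1 : K) ∈ powerIdeal K D := by
  have h1 : (X i : MvPolynomial σ K) ^ (D {i} + 1) ∈ powerIdeal K D :=
    Ideal.subset_span ⟨{i}, Finset.singleton_nonempty i, by rw [Finset.sum_singleton]⟩
  refine Ideal.mem_of_dvd _ ?_ h1
  rw [X_pow_eq_monomial]
  exact monomial_dvd_monomial.mpr ⟨Or.inr (Finsupp.single_le_iff.mpr h), dvd_rfl⟩

variable [Fintype σ]

/-- The pairing of polynomials in which distinct monomials are orthogonal and `⟨x^m, x^m⟩ = m!`;
multiplication by `x_i` is adjoint to `∂/∂x_i`. -/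
noncomputable def polyDual : MvPolynomial σ K →ₗ[K] Module.Dual K (MvPolynomial σ K) where
  toFun f := (basisMonomials σ K).constr K fun m => coeff m f * (∏ i, (m i).factorial : ℕ)
  map_add' f g := (basisMonomials σ K).ext fun m => by
    rw [LinearMap.add_apply]
    simp only [Module.Basis.constr_basis, coeff_add]
    ring
  map_smul' a f := (basisMonomials σ K).ext fun m => by
    rw [LinearMap.smul_apply]
    simp only [Module.Basis.constr_basis, coeff_smul, smul_eq_mul, RingHom.id_apply]
    ring

lemma polyDual_monomial (f : MvPolynomial σ K) (m : σ →₀ ℕ) (a : K) :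
    polyDual f (monomial m a) = a * (coeff m f * (∏ i, (m i).factorial : ℕ)) := by
  have h : polyDual f (monomial m 1) = coeff m f * (∏ i, (m i).factorial : ℕ) := by
    rw [← congrFun (coe_basisMonomials σ K) m]
    exact Module.Basis.constr_basis (basisMonomials σ K) K _ m
  rw [← h, ← smul_eq_mul, ← map_smul, smul_monomial, smul_eq_mul, mul_one]

lemma polyDual_injective [CharZero K] :
    Function.Injective (polyDual : MvPolynomial σ K →ₗ[K] _) := by
  refine (injective_iff_map_eq_zero _).mpr fun f hf => ?_
  ext m
  have h := polyDual_monomial f m 1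
  rw [hf, LinearMap.zero_apply, one_mul, eq_comm, mul_eq_zero] at h
  refine h.resolve_right ?_
  exact_mod_cast Finset.prod_ne_zero_iff.mpr fun i _ => (m i).factorial_ne_zero

variable [DecidableEq σ]

lemma prod_factorial_add_single (m : σ →₀ ℕ) (i : σ) :
    ∏ j, ((m + Finsupp.single i 1 : σ →₀ ℕ) j).factorial = (m i + 1) * ∏ j, (m j).factorial := by
  rw [← Finset.mul_prod_erase _ _ (Finset.mem_univ i),
    ← Finset.mul_prod_erase _ (fun j => (m j).factorial) (Finset.mem_univ i), ← mul_assoc]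
  congr 1
  · simp [Nat.factorial_succ]
  · refine Finset.prod_congr rfl fun j hj => ?_
    simp [(Finset.ne_of_mem_erase hj).symm]

lemma polyDual_X_mul (f p : MvPolynomial σ K) (i : σ) :
    polyDual f (X i * p) = polyDual (pderiv i f) p := by
  induction p using MvPolynomial.induction_on' with
  | monomial m a =>
    rw [X, monomial_mul, one_mul, add_comm, polyDual_monomial, polyDual_monomial, coeff_pderiv,
      prod_factorial_add_single]
    push_cast
    ring
  | add p q hp hq => rw [mul_add, map_add, map_add, hp, hq]

lemma polyDual_sum_X_pow_mul (I : Finset σ) (k : ℕ) (f p : MvPolynomial σ K) :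
    polyDual f ((∑ i ∈ I, X i) ^ k * p) = polyDual ((dirDeriv K I)^[k] f) p := by
  induction k generalizing f with
  | zero => simp
  | succ k ih =>
    rw [Function.iterate_succ_apply, ← ih, dirDeriv_eq_sum, pow_succ', mul_assoc, Finset.sum_mul,
      map_sum, map_sum, LinearMap.sum_apply]
    exact Finset.sum_congr rfl fun i _ => polyDual_X_mul _ _ _

lemma mem_invSystem_iff_polyDual [CharZero K] (D : Finset σ → ℕ) (f : MvPolynomial σ K) :
    f ∈ invSystem K D ↔ ∀ p ∈ powerIdeal K D, polyDual f p = 0 := by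
  rw [mem_invSystem]
  constructor
  · intro hf p hp
    suffices h : ∀ q, polyDual f (p * q) = 0 by simpa using h 1
    induction hp using Submodule.span_induction with
    | mem x hx =>
      obtain ⟨I, -, rfl⟩ := hx
      intro q
      rw [polyDual_sum_X_pow_mul, hf, map_zero, LinearMap.zero_apply]
    | zero => simp
    | add x y _ _ hx hy =>
      intro q
      rw [add_mul, map_add, hx, hy, add_zero]
    | smul a x _ hx =>
      intro q
      rw [smul_eq_mul, mul_comm a x, mul_assoc, hx]
  · intro hf I
    rcases I.eq_empty_or_nonempty with rfl | hI
    · rw [Function.iterate_succ_apply', dirDeriv_eq_sum, Finset.sum_empty]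
    · refine polyDual_injective (LinearMap.ext fun p => ?_)
      rw [← polyDual_sum_X_pow_mul, map_zero, LinearMap.zero_apply]
      exact hf _ (Ideal.mul_mem_right _ _ (Ideal.subset_span ⟨I, hI, rfl⟩))

lemma map_polyDual_invSystem [CharZero K] (D : Finset σ → ℕ) :
    (invSystem K D).map polyDual
      = ((powerIdeal K D).restrictScalars K).dualAnnihilator := by
  ext φ
  rw [Submodule.mem_dualAnnihilator]
  constructor
  · rintro ⟨f, hf, rfl⟩ p hp
    exact (mem_invSystem_iff_polyDual D f).mp hf p hp
  · intro hφ
    obtain ⟨f, rfl⟩ : ∃ f, polyDual f = φ := by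
      refine ⟨∑ m ∈ Finset.Iic (Finsupp.equivFunOnFinite.symm fun i => D {i}),
        monomial m (φ (monomial m 1) / (∏ i, (m i).factorial : ℕ)),
        (basisMonomials σ K).ext fun m => ?_⟩
      rw [coe_basisMonomials]
      dsimp only
      rw [polyDual_monomial, coeff_sum]
      simp only [coeff_monomial, Finset.sum_ite_eq', Finset.mem_Iic, one_mul]
      split_ifs with hm
      · refine div_mul_cancel₀ _ ?_
        exact_mod_cast Finset.prod_ne_zero_iff.mpr fun i _ => (m i).factorial_ne_zero
      · obtain ⟨i, hi⟩ : ∃ i, D {i} < m i := by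
          by_contra! h
          exact hm h
        rw [zero_mul, hφ _ (monomial_mem_powerIdeal D hi)]
    exact ⟨f, (mem_invSystem_iff_polyDual D f).mpr hφ, rfl⟩

theorem finrank_quotient_powerIdeal [CharZero K] (D : Finset σ → ℕ) :
    Module.finrank K (MvPolynomial σ K ⧸ powerIdeal K D)
      = Module.finrank K (invSystem K D) := by
  rw [← (Submodule.Quotient.restrictScalarsEquiv K (powerIdeal K D)).finrank_eq,
    ← Subspace.dual_finrank_eq, (Submodule.dualQuotEquivDualAnnihilator _).finrank_eq,
    ← map_polyDual_invSystem]
  exact (Submodule.equivMapOfInjective _ polyDual_injective _).finrank_eq.symm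

end Duality

section Count

variable {σ : Type*} [DecidableEq σ]

lemma listCrossCount_append (L L' : List (σ × σ)) (I : Finset σ) :
    listCrossCount (L ++ L') I = listCrossCount L I + listCrossCount L' I :=
  List.countP_append

lemma listCrossCount_replicate (t : ℕ) (e : σ × σ) (I : Finset σ) :
    listCrossCount (List.replicate t e) I = if (e.1 ∈ I ↔ e.2 ∈ I) then 0 else t := by
  simp [listCrossCount, List.countP_replicate]

lemma listCrossCount_replicate_loop_append (t : ℕ) {e : σ × σ} (he : e.1 = e.2)
    (L : List (σ × σ)) : listCrossCount (List.replicate t e ++ L) = listCrossCount L := by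
  ext I
  simp [listCrossCount_append, listCrossCount_replicate, he]

variable [Fintype σ] {K : Type*} [Field K] [CharZero K]

lemma finrank_invSystem_replicate_append {e : σ × σ} (he : e.1 ≠ e.2) (t : ℕ)
    (L : List (σ × σ)) :
    Module.finrank K (invSystem K (listCrossCount (List.replicate t e ++ L)))
      = Module.finrank K (invSystem K (listCrossCount L))
        + t * Module.finrank K (invSystem K (listCrossCount
            (L.map (Prod.map (mergeVertex e.1 e.2) (mergeVertex e.1 e.2))))) := by
  induction t with
  | zero => simp
  | succ t ih =>
    have hloop : (Prod.map (mergeVertex e.1 e.2) (mergeVertex e.1 e.2) e).1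
        = (Prod.map (mergeVertex e.1 e.2) (mergeVertex e.1 e.2) e).2 := by
      simp [mergeVertex_self, mergeVertex_left]
    rw [List.replicate_succ, List.cons_append, finrank_invSystem_cons he, ih, List.map_append,
      List.map_replicate, listCrossCount_replicate_loop_append t hloop]
    ring

open scoped Classical in
theorem finrank_invSystem_eq_sum_forests (t : ℕ) (l : List E) (hl : l.Nodup) (p : E → σ × σ) :
    Module.finrank K (invSystem K (listCrossCount (l.flatMap fun e => List.replicate t (p e))))
      = ∑ A ∈ l.toFinset.powerset,
          if IsForest (fun e => s((p e).1, (p e).2)) A then t ^ A.card else 0 := by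
  induction l generalizing p with
  | nil =>
    rw [List.flatMap_nil, finrank_invSystem_nil]
    simp [IsForest, numComponents_empty]
  | cons e l ih =>
    obtain ⟨hel, hl⟩ := List.nodup_cons.mp hl
    rw [← List.mem_toFinset] at hel
    have notMem {A : Finset E} (hA : A ∈ l.toFinset.powerset) : e ∉ A :=
      fun h => hel (Finset.mem_powerset.mp hA h)
    rw [List.flatMap_cons, List.toFinset_cons, Finset.sum_powerset_insert hel, ← ih hl]
    by_cases he : (p e).1 = (p e).2
    · rw [listCrossCount_replicate_loop_append t he, left_eq_add]
      refine Finset.sum_eq_zero fun A hA => if_neg ?_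
      exact not_isForest_insert_loop (u := (p e).1) (by rw [← he]) (notMem hA)
    · rw [finrank_invSystem_replicate_append he]
      congr 1
      have hmap : (l.flatMap fun e => List.replicate t (p e)).map
            (Prod.map (mergeVertex (p e).1 (p e).2) (mergeVertex (p e).1 (p e).2))
          = l.flatMap fun e' => List.replicate t
            ((Prod.map (mergeVertex (p e).1 (p e).2) (mergeVertex (p e).1 (p e).2) ∘ p) e') := by
        simp [List.map_flatMap]
      rw [hmap, ih hl, Finset.mul_sum]
      refine Finset.sum_congr rfl fun A hA => ?_
      rw [isForest_insert_iff (e := e) he rfl (notMem hA), Finset.card_insert_of_notMem (notMem hA),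
        mul_ite, mul_zero, pow_succ']
      rfl

lemma listCrossCount_flatMap_replicate [Fintype E] {n : ℕ} (p : E → Fin n × Fin n) (t : ℕ)
    (I : Finset (Fin n)) :
    listCrossCount ((Finset.univ : Finset E).toList.flatMap fun e => List.replicate t (p e)) I
      = t * crossCount (fun e => s((p e).1, (p e).2)) I := by
  have h : {e : E | (∃ v ∈ s((p e).1, (p e).2), v ∈ I) ∧ ∃ w ∈ s((p e).1, (p e).2), w ∉ I}
      = ((Finset.univ.filter fun e => ¬((p e).1 ∈ I ↔ (p e).2 ∈ I) : Finset E) : Set E) := by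
    ext e
    simp only [Set.mem_ofPred_eq, Sym2.mem_iff, Finset.coe_filter, Finset.mem_univ, true_and]
    constructor
    · rintro ⟨⟨v, rfl | rfl, hv⟩, w, rfl | rfl, hw⟩ <;> tauto
    · intro h
      by_cases h1 : (p e).1 ∈ I
      · exact ⟨⟨_, Or.inl rfl, h1⟩, _, Or.inr rfl, by tauto⟩
      · exact ⟨⟨_, Or.inr rfl, by tauto⟩, _, Or.inl rfl, h1⟩
  rw [crossCount, h, Set.ncard_coe_finset, listCrossCount, List.countP_flatMap]
  have h2 (e : E) : List.countP (fun e : Fin n × Fin n => decide ¬(e.1 ∈ I ↔ e.2 ∈ I))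
      (List.replicate t (p e)) = if ¬((p e).1 ∈ I ↔ (p e).2 ∈ I) then t else 0 := by
    simp [List.countP_replicate]
  simp only [Function.comp_def, h2]
  rw [Finset.sum_map_toList, ← Finset.sum_filter, Finset.sum_const, smul_eq_mul, mul_comm]

end Count

open scoped Classical in
/-- Let `G` be a finite multigraph on vertices `1,…,n`,
`t ≥ 1` and `K` a field of characteristic `0`. Then
`dim_K B_G^{F_t} = Σ_F t^{|F|}` (sum over all subforests `F` of `G`), and this
common value equals `t^{v(G)-c(G)} · T_G(1 + 1/t, 1)`. -/
theorem dim_B_Ft_eq_tutte_value {n : ℕ} {E : Type} [Fintype E]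
    (ends : E → Sym2 (Fin n)) (t : ℕ) (ht : 1 ≤ t)
    (K : Type) [Field K] [CharZero K] :
    (Module.finrank K (MvPolynomial (Fin n) K ⧸ forestIdeal K t ends)
      = ∑ A ∈ (Finset.univ : Finset E).powerset,
          if IsForest ends A then t ^ A.card else 0) ∧
    ((∑ A ∈ (Finset.univ : Finset E).powerset,
        if IsForest ends A then t ^ A.card else 0 : ℕ) : ℚ)
      = (t : ℚ) ^ (n - numComponents ends (Finset.univ : Finset E))
        * tutte ends (1 + 1 / (t : ℚ)) 1 := by
  refine ⟨?_, ?_⟩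
  · obtain ⟨p, rfl⟩ : ∃ p : E → Fin n × Fin n, (fun e => s((p e).1, (p e).2)) = ends :=
      ⟨fun e => (ends e).out, funext fun e => Quot.out_eq (ends e)⟩
    have h := finrank_invSystem_eq_sum_forests (K := K) t _
      (Finset.nodup_toList (Finset.univ : Finset E)) p
    rw [Finset.toList_toFinset] at h
    rw [← h, ← finrank_quotient_powerIdeal, funext (listCrossCount_flatMap_replicate p t)]
    rfl
  · simpa only [Nat.card_fin] using sum_forests_eq_tutte ends (Nat.one_le_iff_ne_zero.mp ht)

end ForestAlg
end

section
/- Let G be a finite multigraph with a linear order on its edges. Then T_G(x,y) = Σ_F (x−1)^{(v(G)−c(G))−|F|} · y^{act_G(F)}, where the sum ranges over all subforests F of G. In particular, for each pair (a,b) the number of subforests F with |F| = a and act_G(F) = b does not depend on the chosen linear order of the edges. -/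
open MvPolynomial

namespace ForestAlg

variable {V E : Type*}

/-- The edge `e` joins two vertices of the same component of `(V, A)`. -/
def Spans (ends : E → Sym2 V) (A : Finset E) (e : E) : Prop :=
  ∀ v w, ends e = s(v, w) → Quot.mk (edgeRel ends A) v = Quot.mk (edgeRel ends A) w

section Spans

variable {ends : E → Sym2 V} {A B : Finset E} {e f : E}

lemma spans_of_mem (he : e ∈ A) : Spans ends A e :=
  fun _ _ h => Quot.sound ⟨e, he, h⟩

lemma quot_mk_eq_of_forall_mem_spans (h : ∀ f ∈ B, Spans ends A f) {v w : V}
    (hvw : Quot.mk (edgeRel ends B) v = Quot.mk (edgeRel ends B) w) :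
    Quot.mk (edgeRel ends A) v = Quot.mk (edgeRel ends A) w :=
  congrArg (Quot.lift (Quot.mk (edgeRel ends A))
    fun _ _ ⟨f, hf, hvw⟩ => h f hf _ _ hvw) hvw

lemma Spans.trans (he : Spans ends B e) (h : ∀ f ∈ B, Spans ends A f) : Spans ends A e :=
  fun v w hvw => quot_mk_eq_of_forall_mem_spans h (he v w hvw)

lemma Spans.mono (he : Spans ends A e) (h : A ⊆ B) : Spans ends B e :=
  he.trans fun _ hf => spans_of_mem (h hf)

lemma numComponents_eq_of_spans (hA : ∀ e ∈ A, Spans ends B e) (hB : ∀ e ∈ B, Spans ends A e) :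
    numComponents ends A = numComponents ends B :=
  Nat.card_congr
    { toFun := Quot.lift (Quot.mk _) fun _ _ ⟨f, hf, hvw⟩ => hA f hf _ _ hvw
      invFun := Quot.lift (Quot.mk _) fun _ _ ⟨f, hf, hvw⟩ => hB f hf _ _ hvw
      left_inv := by rintro ⟨v⟩; rfl
      right_inv := by rintro ⟨v⟩; rfl }

lemma numComponents_insert_of_spans [DecidableEq E] (he : Spans ends A e) :
    numComponents ends (insert e A) = numComponents ends A := by
  refine numComponents_eq_of_spans (fun f hf => ?_)
    fun f hf => spans_of_mem (Finset.mem_insert_of_mem hf)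
  rcases Finset.mem_insert.mp hf with rfl | hf
  · exact he
  · exact spans_of_mem hf

open scoped Classical in
lemma numComponents_insert_of_not_spans [Finite V] [DecidableEq E] (he : ¬ Spans ends A e) :
    numComponents ends (insert e A) + 1 = numComponents ends A := by
  simp only [Spans, not_forall] at he
  obtain ⟨u, v, huv, hne⟩ := he
  let mk : V → Quot (edgeRel ends A) := Quot.mk _
  let merge (w : V) : {q // q ≠ mk v} :=
    if h : mk w = mk v then ⟨mk u, hne⟩ else ⟨mk w, h⟩
  have merge_eq (a b : V) (h : edgeRel ends (insert e A) a b) : merge a = merge b := by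
    obtain ⟨f, hf, hab⟩ := h
    rcases Finset.mem_insert.mp hf with rfl | hf
    · rw [huv, Sym2.eq_iff] at hab
      rcases hab with ⟨rfl, rfl⟩ | ⟨rfl, rfl⟩ <;> simp [merge, mk, hne]
    · have : mk a = mk b := Quot.sound ⟨f, hf, hab⟩
      simp only [merge, this]
  have mk_eq : Quot.mk (edgeRel ends (insert e A)) u = Quot.mk _ v :=
    Quot.sound ⟨e, Finset.mem_insert_self _ _, huv⟩
  let lower : Quot (edgeRel ends A) → Quot (edgeRel ends (insert e A)) :=
    Quot.lift (Quot.mk _) fun _ _ ⟨f, hf, h⟩ =>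
      Quot.sound ⟨f, Finset.mem_insert_of_mem hf, h⟩
  have lower_merge (w : V) : lower (merge w) = Quot.mk _ w := by
    by_cases h : mk w = mk v
    · have h' : Quot.mk (edgeRel ends (insert e A)) w = Quot.mk _ v := congrArg lower h
      simp only [merge, h, dif_pos]
      exact mk_eq.trans h'.symm
    · simp only [merge, h, dif_neg, not_false_eq_true]
      rfl
  let equiv : Quot (edgeRel ends (insert e A)) ≃ {q // q ≠ mk v} :=
    { toFun := Quot.lift merge merge_eq
      invFun := fun q => lower q
      left_inv := by rintro ⟨w⟩; exact lower_merge w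
      right_inv := by
        rintro ⟨⟨w⟩, hw⟩
        exact dif_neg hw }
  have := Fintype.ofFinite (Quot (edgeRel ends A))
  have hpos : 0 < Nat.card (Quot (edgeRel ends A)) :=
    Nat.card_pos_iff.mpr ⟨⟨mk v⟩, inferInstance⟩
  rw [numComponents, numComponents, Nat.card_congr equiv]
  rw [Nat.card_eq_fintype_card] at hpos ⊢
  rw [Nat.card_eq_fintype_card, Fintype.card_subtype_compl, Fintype.card_subtype_eq]
  omega

lemma rank_add_numComponents [Finite V] (ends : E → Sym2 V) (A : Finset E) :
    rank ends A + numComponents ends A = Nat.card V :=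
  Nat.sub_add_cancel (Nat.card_le_card_of_surjective _ Quot.mk_surjective)

lemma isForest_iff [Finite V] : IsForest ends A ↔ rank ends A = A.card := by
  have := rank_add_numComponents ends A
  rw [IsForest]
  omega

lemma rank_insert_of_spans [DecidableEq E] (he : Spans ends A e) :
    rank ends (insert e A) = rank ends A := by
  rw [rank, rank, numComponents_insert_of_spans he]

lemma rank_insert_of_not_spans [Finite V] [DecidableEq E] (he : ¬ Spans ends A e) :
    rank ends (insert e A) = rank ends A + 1 := by
  have := numComponents_insert_of_not_spans he
  have := rank_add_numComponents ends A
  have := rank_add_numComponents ends (insert e A)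
  omega

lemma rank_insert_eq_iff [Finite V] [DecidableEq E] :
    rank ends (insert e A) = rank ends A ↔ Spans ends A e := by
  refine ⟨fun h => ?_, rank_insert_of_spans⟩
  by_contra he
  have := rank_insert_of_not_spans he
  omega

lemma rank_le_card [Finite V] (ends : E → Sym2 V) (A : Finset E) : rank ends A ≤ A.card := by
  classical
  induction A using Finset.induction_on with
  | empty =>
    have : numComponents ends ∅ = Nat.card V :=
      (Nat.card_congr (Equiv.ofBijective (Quot.mk (edgeRel ends ∅))
        ⟨fun v w h => congrArg (Quot.lift id fun _ _ ⟨_, hf, _⟩ => by simp at hf) h,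
          Quot.mk_surjective⟩)).symm
    simp [rank, this]
  | insert e A he ih =>
    rw [Finset.card_insert_of_notMem he]
    by_cases h : Spans ends A e
    · rw [rank_insert_of_spans h]
      omega
    · rw [rank_insert_of_not_spans h]
      omega

lemma rank_mono [Finite V] (h : A ⊆ B) : rank ends A ≤ rank ends B := by
  have : numComponents ends B ≤ numComponents ends A :=
    Nat.card_le_card_of_surjective
      (Quot.lift (Quot.mk _) fun _ _ ⟨f, hf, hvw⟩ => Quot.sound ⟨f, h hf, hvw⟩)
      (by rintro ⟨v⟩; exact ⟨Quot.mk _ v, rfl⟩)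
  exact Nat.sub_le_sub_left this _

lemma Spans.exchange [Finite V] [DecidableEq E] (h : Spans ends (insert f A) e)
    (he : ¬ Spans ends A e) : Spans ends (insert e A) f := by
  by_contra hf
  have h1 := rank_insert_of_spans h
  have h2 := rank_insert_of_not_spans he
  have h3 := rank_insert_of_not_spans hf
  rw [Finset.insert_comm] at h3
  by_cases h4 : Spans ends A f
  · have := rank_insert_of_spans h4
    omega
  · have := rank_insert_of_not_spans h4
    omega

lemma IsForest.not_spans_erase [Finite V] [DecidableEq E] (hA : IsForest ends A) (he : e ∈ A) :
    ¬ Spans ends (A.erase e) e := by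
  intro h
  have h1 := rank_insert_of_spans h
  rw [Finset.insert_erase he, isForest_iff.mp hA] at h1
  have := rank_le_card ends (A.erase e)
  have := Finset.card_erase_lt_of_mem he
  omega

lemma IsForest.insert_iff [Finite V] [DecidableEq E] (hA : IsForest ends A) (he : e ∉ A) :
    IsForest ends (insert e A) ↔ ¬ Spans ends A e := by
  rw [isForest_iff, Finset.card_insert_of_notMem he, ← isForest_iff.mp hA,
    ← rank_insert_eq_iff]
  by_cases h : Spans ends A e
  · simp [rank_insert_of_spans h]
  · simp [rank_insert_of_not_spans h]

end Spans

section Order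

variable [LinearOrder E] {ends : E → Sym2 V} {A F : Finset E} {e : E}

lemma IsForest.not_spans_filter_lt [Finite V] (hF : IsForest ends F) (he : e ∈ F) :
    ¬ Spans ends {f ∈ F | e < f} e :=
  fun h => hF.not_spans_erase he <| h.mono fun f hf => by
    rw [Finset.mem_filter] at hf
    exact Finset.mem_erase.mpr ⟨hf.2.ne', hf.1⟩

lemma isForest_of_forall_not_spans_filter_lt [Finite V]
    (hF : ∀ e ∈ F, ¬ Spans ends {f ∈ F | e < f} e) : IsForest ends F := by
  induction F using Finset.induction_on_min with
  | empty => simpa [isForest_iff] using rank_le_card ends ∅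
  | insert e F hlt ih =>
    have he : e ∉ F := fun h => (hlt e h).false
    have hF' : IsForest ends F := ih fun f hf h => hF f (Finset.mem_insert_of_mem hf) <|
      h.mono (Finset.filter_subset_filter _ (Finset.subset_insert _ _))
    refine (hF'.insert_iff he).mpr fun h => hF e (Finset.mem_insert_self _ _) (h.mono ?_)
    exact fun f hf => Finset.mem_filter.mpr ⟨Finset.mem_insert_of_mem hf, hlt f hf⟩

lemma IsForest.extActive_iff [Finite V] (hF : IsForest ends F) :
    ExtActive ‹LinearOrder E› ends F e ↔ e ∉ F ∧ Spans ends {f ∈ F | e < f} e := by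
  refine and_congr_right fun he => ?_
  rw [hF.insert_iff he, not_not]
  have rank_erase (f : E) (hf : f ∈ insert e F) :
      rank ends ((insert e F).erase f) = rank ends (insert e F) ↔
        Spans ends ((insert e F).erase f) f := by
    rw [← rank_insert_eq_iff, Finset.insert_erase hf, eq_comm]
  constructor
  · rintro ⟨hspan, hmin⟩
    obtain ⟨D, hDF, hD⟩ := exists_minimal_le_of_wellFoundedLT (Spans ends · e) F hspan
    refine hD.prop.mono fun f hf => Finset.mem_filter.mpr ⟨hDF hf, ?_⟩
    have hfe : f ≠ e := fun h => he (h ▸ hDF hf)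
    have hne : ¬ Spans ends (D.erase f) e := fun h =>
      Finset.notMem_erase f D (hD.le_of_le h (Finset.erase_subset f D) hf)
    have hex : Spans ends (insert e (D.erase f)) f :=
      Spans.exchange (by rw [Finset.insert_erase hf]; exact hD.prop) hne
    have hfF : f ∈ insert e F := Finset.mem_insert_of_mem (hDF hf)
    refine lt_of_le_of_ne (hmin f hfF ((rank_erase f hfF).mpr (hex.mono ?_))) hfe.symm
    rw [Finset.erase_insert_of_ne hfe.symm]
    exact Finset.insert_subset_insert _ (Finset.erase_subset_erase _ hDF)
  · intro h
    refine ⟨h.mono (Finset.filter_subset _ _), fun f hf hrank => ?_⟩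
    rw [rank_erase f hf] at hrank
    by_contra hlt
    replace hlt : f < e := not_le.mp hlt
    have hfF : f ∈ F := Finset.mem_of_mem_insert_of_ne hf hlt.ne
    refine hF.not_spans_erase hfF (hrank.trans fun g hg => ?_)
    obtain ⟨hgf, hg⟩ := Finset.mem_erase.mp hg
    rcases Finset.mem_insert.mp hg with rfl | hg
    · refine h.mono fun k hk => ?_
      rw [Finset.mem_filter] at hk
      exact Finset.mem_erase.mpr ⟨(hlt.trans hk.2).ne', hk.1⟩
    · exact spans_of_mem (Finset.mem_erase.mpr ⟨hgf, hg⟩)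

open scoped Classical in
/-- The spanning forest of `(V, A)` obtained by adding edges greedily from the largest one down. -/
noncomputable def greedyForest (ends : E → Sym2 V) (A : Finset E) : Finset E :=
  {e ∈ A | ¬ Spans ends {f ∈ A | e < f} e}

lemma mem_greedyForest :
    e ∈ greedyForest ends A ↔ e ∈ A ∧ ¬ Spans ends {f ∈ A | e < f} e := by
  simp [greedyForest]

lemma greedyForest_subset : greedyForest ends A ⊆ A :=
  fun _ he => (mem_greedyForest.mp he).1

lemma isForest_greedyForest [Finite V] : IsForest ends (greedyForest ends A) :=
  isForest_of_forall_not_spans_filter_lt fun _ he h => (mem_greedyForest.mp he).2 <|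
    h.mono (Finset.filter_subset_filter _ greedyForest_subset)

lemma Spans.greedyForest_filter_lt [Finite E] (h : Spans ends {f ∈ A | e < f} e) :
    Spans ends {f ∈ greedyForest ends A | e < f} e := by
  induction e using WellFoundedGT.induction with
  | ind e ih =>
    refine h.trans fun f hf => ?_
    obtain ⟨hfA, hef⟩ := Finset.mem_filter.mp hf
    by_cases hfG : f ∈ greedyForest ends A
    · exact spans_of_mem (Finset.mem_filter.mpr ⟨hfG, hef⟩)
    · have hf : Spans ends {g ∈ A | f < g} f := by
        simpa [mem_greedyForest, hfA] using hfG
      exact (ih f hef hf).mono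
        (Finset.monotone_filter_right _ fun g _ hg => hef.trans hg)

lemma spans_filter_lt_of_notMem_greedyForest [Finite E] (he : e ∈ A)
    (he' : e ∉ greedyForest ends A) : Spans ends {f ∈ greedyForest ends A | e < f} e :=
  Spans.greedyForest_filter_lt (by simpa [mem_greedyForest, he] using he')

lemma rank_eq_card_greedyForest [Finite V] [Finite E] :
    rank ends A = (greedyForest ends A).card := by
  rw [← isForest_iff.mp isForest_greedyForest, rank, rank, numComponents_eq_of_spans]
  · intro e he
    by_cases he' : e ∈ greedyForest ends A
    · exact spans_of_mem he'
    · exact (spans_filter_lt_of_notMem_greedyForest he he').mono (Finset.filter_subset _ _)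
  · exact fun e he => spans_of_mem (greedyForest_subset he)

lemma IsForest.greedyForest_eq_iff [Finite V] [Finite E] (hF : IsForest ends F) :
    greedyForest ends A = F ↔
      F ⊆ A ∧ ∀ e ∈ A, e ∉ F → ExtActive ‹LinearOrder E› ends F e := by
  constructor
  · rintro rfl
    exact ⟨greedyForest_subset, fun e he he' =>
      hF.extActive_iff.mpr ⟨he', spans_filter_lt_of_notMem_greedyForest he he'⟩⟩
  · rintro ⟨hFA, hact⟩
    ext e
    rw [mem_greedyForest]
    constructor
    · rintro ⟨he, hns⟩
      by_contra heF
      exact hns ((hF.extActive_iff.mp (hact e he heF)).2.mono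
        (Finset.filter_subset_filter _ hFA))
    · refine fun he => ⟨hFA he, fun h => hF.not_spans_filter_lt he (h.trans fun f hf => ?_)⟩
      obtain ⟨hfA, hef⟩ := Finset.mem_filter.mp hf
      by_cases hfF : f ∈ F
      · exact spans_of_mem (Finset.mem_filter.mpr ⟨hfF, hef⟩)
      · exact (hF.extActive_iff.mp (hact f hfA hfF)).2.mono
          (Finset.monotone_filter_right _ fun g _ hg => hef.trans hg)

open scoped Classical in
lemma IsForest.sum_greedyForest_fiber [Finite V] [Fintype E] {R : Type*} [CommRing R]
    (hF : IsForest ends F) (y : R) :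
    ∑ A ∈ {A | greedyForest ends A = F}, (y - 1) ^ (A.card - F.card) =
      y ^ act ‹LinearOrder E› ends F := by
  let active : Finset E := {e | ExtActive ‹LinearOrder E› ends F e}
  have hact : act ‹LinearOrder E› ends F = active.card := by
    rw [act, ← Set.ncard_coe_finset]
    simp [active]
  have hdisj : Disjoint F active := by
    rw [Finset.disjoint_left]
    intro e he hea
    exact (Finset.mem_filter.mp hea).2.1 he
  have hpow : y ^ active.card = ∑ S ∈ active.powerset, (y - 1) ^ S.card := by
    simpa using (Finset.sum_pow_mul_eq_add_pow (y - 1) 1 active).symm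
  rw [hact, hpow]
  refine Finset.sum_bij' (fun A _ => A \ F) (fun S _ => F ∪ S) ?_ ?_ ?_ ?_ ?_
  · intro A hA
    rw [Finset.mem_filter_univ, hF.greedyForest_eq_iff] at hA
    rw [Finset.mem_powerset]
    intro e he
    rw [Finset.mem_sdiff] at he
    exact Finset.mem_filter.mpr ⟨Finset.mem_univ _, hA.2 e he.1 he.2⟩
  · intro S hS
    rw [Finset.mem_powerset] at hS
    rw [Finset.mem_filter_univ, hF.greedyForest_eq_iff]
    refine ⟨Finset.subset_union_left, fun e he heF => ?_⟩
    exact (Finset.mem_filter.mp (hS ((Finset.mem_union.mp he).resolve_left heF))).2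
  · intro A hA
    rw [Finset.mem_filter_univ, hF.greedyForest_eq_iff] at hA
    exact Finset.union_sdiff_of_subset hA.1
  · intro S hS
    exact Finset.union_sdiff_cancel_left
      (Finset.disjoint_of_subset_right (Finset.mem_powerset.mp hS) hdisj)
  · intro A hA
    rw [Finset.mem_filter_univ, hF.greedyForest_eq_iff] at hA
    rw [Finset.card_sdiff_of_subset hA.1]

end Order

open scoped Classical in
lemma tutte_eq_sum_isForest [Finite V] [Fintype E] [DecidableEq E] (o : LinearOrder E)
    (ends : E → Sym2 V) {R : Type*} [CommRing R] (x y : R) :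
    tutte ends x y = ∑ F with IsForest ends F,
      (x - 1) ^ (rank ends Finset.univ - F.card) * y ^ act o ends F := by
  obtain rfl : ‹DecidableEq E› = o.toDecidableEq := Subsingleton.elim _ _
  rw [tutte, Finset.powerset_univ,
    ← Finset.sum_fiberwise_of_maps_to (g := greedyForest ends) (t := {F | IsForest ends F})
      fun A _ => by simpa using isForest_greedyForest]
  refine Finset.sum_congr rfl fun F hF => ?_
  rw [Finset.mem_filter_univ] at hF
  rw [← hF.sum_greedyForest_fiber, Finset.mul_sum]
  refine Finset.sum_congr rfl fun A hA => ?_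
  rw [Finset.mem_filter_univ] at hA
  rw [rank_eq_card_greedyForest (A := A), hA]

open scoped Classical Polynomial in
lemma card_isForest_card_act_eq_coeff [Finite V] [Fintype E] [DecidableEq E] (o : LinearOrder E)
    (ends : E → Sym2 V) {a : ℕ} (ha : a ≤ rank ends Finset.univ) (b : ℕ) :
    (Nat.card {A : Finset E // IsForest ends A ∧ A.card = a ∧ act o ends A = b} : ℤ) =
      ((tutte ends (Polynomial.C Polynomial.X + 1) Polynomial.X : ℤ[X][X]).coeff b).coeff
        (rank ends Finset.univ - a) := by
  rw [tutte_eq_sum_isForest o, Nat.card_eq_fintype_card, Fintype.card_subtype,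
    Finset.card_filter, Finset.sum_filter, Polynomial.finsetSum_coeff,
    Polynomial.finsetSum_coeff]
  push_cast
  refine Finset.sum_congr rfl fun F _ => ?_
  by_cases hF : IsForest ends F
  · have hle : F.card ≤ rank ends Finset.univ :=
      isForest_iff.mp hF ▸ rank_mono (Finset.subset_univ F)
    have hiff : rank ends Finset.univ - a = rank ends Finset.univ - F.card ↔ F.card = a := by
      omega
    rw [if_pos hF, add_sub_cancel_right, ← Polynomial.C_pow, Polynomial.coeff_C_mul_X_pow,
      apply_ite (Polynomial.coeff · _), Polynomial.coeff_X_pow, Polynomial.coeff_zero]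
    simp only [hF, hiff, true_and, eq_comm (a := b), ← ite_and, and_comm (a := F.card = a)]
  · simp [hF]

open scoped Classical in
/-- Let `G` be a finite multigraph with a linear order `o` on
its edges. Then `T_G(x,y) = Σ_F (x-1)^{(v(G)-c(G))-|F|} · y^{act_G(F)}`, the sum
ranging over all subforests `F` of `G`. In particular, for each pair `(a, b)`
the number of subforests `F` with `|F| = a` and `act_G(F) = b` does not depend
on the chosen linear order of the edges. -/
theorem tutte_eq_sum_subforests {U E : Type} [Finite U] [Fintype E]
    [DecidableEq E] (o : LinearOrder E) (ends : E → Sym2 U)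
    {R : Type} [CommRing R] (x y : R) :
    (tutte ends x y
      = ∑ A ∈ (Finset.univ : Finset E).powerset,
          if IsForest ends A then
            (x - 1) ^ ((Nat.card U - numComponents ends Finset.univ) - A.card)
              * y ^ act o ends A
          else 0) ∧
    ∀ (o₁ o₂ : LinearOrder E) (a b : ℕ),
      Nat.card {A : Finset E // IsForest ends A ∧ A.card = a ∧
          act o₁ ends A = b}
        = Nat.card {A : Finset E // IsForest ends A ∧ A.card = a ∧
            act o₂ ends A = b} := by
  constructor
  · rw [tutte_eq_sum_isForest o, Finset.sum_filter, Finset.powerset_univ]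
    rfl
  · intro o₁ o₂ a b
    by_cases ha : a ≤ rank ends Finset.univ
    · have h₁ := card_isForest_card_act_eq_coeff o₁ ends ha b
      have h₂ := card_isForest_card_act_eq_coeff o₂ ends ha b
      exact_mod_cast h₁.trans h₂.symm
    · have hempty (o : LinearOrder E) : IsEmpty {A : Finset E // IsForest ends A ∧ A.card = a ∧
          act o ends A = b} := by
        refine ⟨fun ⟨A, hA, hcard, _⟩ => ha ?_⟩
        rw [← hcard, ← isForest_iff.mp hA]
        exact rank_mono (Finset.subset_univ A)
      have := hempty o₁
      have := hempty o₂
      simp only [Nat.card_of_isEmpty]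

end ForestAlg
end
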